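/- Let X be a compact Hausdorff space, A a semisimple commutative unital Banach algebra, and 𝑨 an admissible Banach A-valued function algebra on X with 𝔄 = 𝑨 ∩ C(X). If 𝑨 satisfies Ditkin's condition then so do 𝔄 and A, and if 𝑨 satisfies strong Ditkin's condition then so do 𝔄 and A. -/

import Mathlib

open WeakDual Topology

namespace VV

variable (B : Type*) [NormedCommRing B] [NormedAlgebra ℂ B]

/-- The ideal `I_ψ = {b | ψ b = 0}`. -/
def Iid (ψ : characterSpace ℂ B) : Set B := {b : B | ψ b = 0}

/-- The ideal `J_ψ` of elements whose Gelfand transform vanishes on a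
neighbourhood of `ψ`. -/
def Jid (ψ : characterSpace ℂ B) : Set B :=
  {b : B | ∃ U ∈ nhds ψ, ∀ χ ∈ U, χ b = 0}

/-- Regularity of a commutative Banach algebra. -/
def IsRegular : Prop :=
  ∀ E : Set (characterSpace ℂ B), IsClosed E →
    ∀ ψ₀ ∉ E, ∃ b : B, ψ₀ b ≠ 0 ∧ ∀ ψ ∈ E, ψ b = 0

def IsStronglyRegularAt (ψ : characterSpace ℂ B) : Prop :=
  Iid B ψ ⊆ closure (Jid B ψ)

def IsStronglyRegular : Prop := ∀ ψ : characterSpace ℂ B, IsStronglyRegularAt B ψ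

/-- Bounded relative units at a character. -/
def HasBRUAt (ψ : characterSpace ℂ B) : Prop :=
  ∃ M : ℝ, 0 < M ∧ ∀ K : Set (characterSpace ℂ B), IsCompact K → ψ ∉ K →
    ∃ b ∈ Jid B ψ, (∀ χ ∈ K, χ b = 1) ∧ ‖b‖ ≤ M

def HasBRU : Prop := ∀ ψ : characterSpace ℂ B, HasBRUAt B ψ

/-- Ditkin's condition at a character: `b ∈ closure (b • J_ψ)` for every `b ∈ I_ψ`. -/
def DitkinAt (ψ : characterSpace ℂ B) : Prop :=
  ∀ b ∈ Iid B ψ, b ∈ closure ((fun u => b * u) '' Jid B ψ)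

def IsDitkin : Prop := ∀ ψ : characterSpace ℂ B, DitkinAt B ψ

/-- `I` has a bounded approximate identity contained in `J`: a bounded net `(u_i)`
in `J` with `‖b * u_i - b‖ → 0` for every `b ∈ I`. -/
def HasBAI (I J : Set B) : Prop :=
  ∃ (ι : Type) (le : ι → ι → Prop) (u : ι → B) (M : ℝ),
    Nonempty ι ∧ (∀ i j : ι, ∃ k, le i k ∧ le j k) ∧
    (∀ i, u i ∈ J) ∧ (∀ i, ‖u i‖ ≤ M) ∧
    ∀ b ∈ I, ∀ ε : ℝ, 0 < ε → ∃ i, ∀ j, le i j → ‖b * u j - b‖ < ε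

/-- Strong Ditkin's condition at `ψ`. -/
def StrongDitkinAt (ψ : characterSpace ℂ B) : Prop := HasBAI B (Iid B ψ) (Jid B ψ)

def IsStrongDitkin : Prop := ∀ ψ : characterSpace ℂ B, StrongDitkinAt B ψ

/-- Normality. -/
def IsNormal : Prop :=
  ∀ E : Set (characterSpace ℂ B), IsClosed E → E ≠ Set.univ →
    ∀ F : Set (characterSpace ℂ B), IsCompact F → (∀ ψ ∈ F, ψ ∉ E) →
      ∃ b : B, (∀ ψ ∈ F, ψ b = 1) ∧ ∀ ψ ∈ E, ψ b = 0

/-- Semisimplicity: the Gelfand transform is injective. -/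
def IsSemisimple : Prop :=
  ∀ b : B, (∀ ψ : characterSpace ℂ B, ψ b = 0) → b = 0



variable (X : Type*) [TopologicalSpace X] [CompactSpace X] [T2Space X]
variable (A : Type*) [NormedCommRing A] [NormedAlgebra ℂ A] [CompleteSpace A] [Nontrivial A]

section FunctionAlgebra

variable (B : Type*) [NormedCommRing B] [NormedAlgebra ℂ B] [CompleteSpace B] [Nontrivial B]

/-- `𝑨` contains the constant functions. -/
def ContainsConstants (ι : B →ₐ[ℂ] C(X, A)) : Prop :=
  ∀ a : A, ∃ b : B, ∀ x : X, ι b x = a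

/-- `𝑨` separates the points of `X`. -/
def Separates (ι : B →ₐ[ℂ] C(X, A)) : Prop :=
  ∀ x y : X, x ≠ y → ∃ b : B, ι b x ≠ ι b y

/-- Admissibility: `φ ∘ f ∈ 𝑨` whenever `f ∈ 𝑨` and `φ ∈ Φ(A)`. -/
def Admissible (ι : B →ₐ[ℂ] C(X, A)) : Prop :=
  ∀ (f : B) (φ : characterSpace ℂ A), ∃ g : B,
    ∀ x : X, ι g x = algebraMap ℂ A (φ (ι f x))

/-- The subalgebra `𝔄 = 𝑨 ∩ C(X)` of scalar-valued members of `𝑨`. -/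
def scalarSub (ι : B →ₐ[ℂ] C(X, A)) : Subalgebra ℂ B where
  carrier := {b : B | ∀ x : X, ∃ c : ℂ, ι b x = algebraMap ℂ A c}
  mul_mem' := by
    intro b b' hb hb' x
    obtain ⟨c, hc⟩ := hb x
    obtain ⟨c', hc'⟩ := hb' x
    refine ⟨c * c', ?_⟩
    rw [map_mul, ContinuousMap.mul_apply, hc, hc', map_mul]
  add_mem' := by
    intro b b' hb hb' x
    obtain ⟨c, hc⟩ := hb x
    obtain ⟨c', hc'⟩ := hb' x
    refine ⟨c + c', ?_⟩
    rw [map_add, ContinuousMap.add_apply, hc, hc', map_add]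
  algebraMap_mem' := by
    intro r x
    refine ⟨r, ?_⟩
    rw [AlgHom.commutes]
    simp [Algebra.algebraMap_eq_smul_one]

/-- `𝑨` is an `A`-valued uniform algebra: its norm is equivalent to the sup norm. -/
def IsUniform (ι : B →ₐ[ℂ] C(X, A)) : Prop :=
  ∃ c C : ℝ, 0 < c ∧ ∀ b : B, c * ‖ι b‖ ≤ ‖b‖ ∧ ‖b‖ ≤ C * ‖ι b‖

/-- Every character of `𝑨` is of the form `ψ ⋄ φ`. -/
def NaturalProduct (ι : B →ₐ[ℂ] C(X, A)) : Prop :=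
  ∀ τ : characterSpace ℂ B,
    ∃ (ψ : characterSpace ℂ (scalarSub X A B ι)) (φ : characterSpace ℂ A),
      ∀ (f : B) (g : scalarSub X A B ι),
        (∀ x : X, ι (g : B) x = algebraMap ℂ A (φ (ι f x))) → τ f = ψ g

end FunctionAlgebra

end VV

namespace VV

section AutomaticContinuity

variable {B C : Type*} [NormedCommRing B] [NormedAlgebra ℂ B] [CompleteSpace B]
  [NormedCommRing C] [NormedAlgebra ℂ C]

/-- A unital algebra homomorphism from a complex Banach algebra to `ℂ`, as a character. -/
noncomputable def characterOfAlgHom (f : B →ₐ[ℂ] ℂ) : characterSpace ℂ B :=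
  CharacterSpace.equivAlgHom.symm f

@[simp]
theorem characterOfAlgHom_apply (f : B →ₐ[ℂ] ℂ) (b : B) : characterOfAlgHom f b = f b :=
  rfl

/-- The pullback of a character along a unital algebra homomorphism. -/
noncomputable def pullback (T : B →ₐ[ℂ] C) (ψ : characterSpace ℂ C) : characterSpace ℂ B :=
  characterOfAlgHom ((CharacterSpace.toAlgHom ψ).comp T)

@[simp]
theorem pullback_apply (T : B →ₐ[ℂ] C) (ψ : characterSpace ℂ C) (b : B) :
    pullback T ψ b = ψ (T b) :=
  rfl

theorem continuous_pullback (T : B →ₐ[ℂ] C) : Continuous (pullback T) := by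
  refine Continuous.subtype_mk (WeakDual.continuous_of_continuous_eval fun b => ?_) _
  exact (WeakDual.eval_continuous (T b)).comp continuous_subtype_val

theorem continuous_character {D : Type*} [NormedCommRing D] [NormedAlgebra ℂ D]
    (χ : characterSpace ℂ D) : Continuous fun b => χ b :=
  map_continuous χ

theorem IsSemisimple.continuous_algHom [CompleteSpace C] (hC : IsSemisimple C)
    (T : B →ₐ[ℂ] C) : Continuous T := by
  refine LinearMap.continuous_of_seq_closed_graph (g := T.toLinearMap) fun u x y hu hTu => ?_
  refine sub_eq_zero.mp (hC _ fun ψ => ?_)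
  have h₁ : Filter.Tendsto (fun n => ψ (T (u n))) Filter.atTop (𝓝 (ψ y)) :=
    ((continuous_character ψ).tendsto y).comp hTu
  have h₂ : Filter.Tendsto (fun n => ψ (T (u n))) Filter.atTop (𝓝 (ψ (T x))) :=
    ((continuous_character (pullback T ψ)).tendsto x).comp hu
  rw [map_sub, sub_eq_zero]
  exact tendsto_nhds_unique h₁ h₂

theorem map_mem_Jid (T : B →ₐ[ℂ] C) {ψ : characterSpace ℂ C} {u : B}
    (hu : u ∈ Jid B (pullback T ψ)) : T u ∈ Jid C ψ := by
  obtain ⟨U, hU, hUu⟩ := hu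
  exact ⟨pullback T ⁻¹' U, (continuous_pullback T).continuousAt hU, fun χ hχ => hUu _ hχ⟩

theorem IsDitkin.of_surjective (hB : IsDitkin B) {T : B →ₐ[ℂ] C} (hT : Continuous T)
    (hs : Function.Surjective T) : IsDitkin C := by
  intro ψ c hc
  obtain ⟨b, rfl⟩ := hs c
  refine map_mem_closure hT (hB (pullback T ψ) b hc) ?_
  rintro _ ⟨u, hu, rfl⟩
  exact ⟨T u, map_mem_Jid T hu, (map_mul T b u).symm⟩

theorem IsStrongDitkin.of_surjective (hB : IsStrongDitkin B) {T : B →ₐ[ℂ] C}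
    (hT : Continuous T) (hs : Function.Surjective T) : IsStrongDitkin C := by
  intro ψ
  obtain ⟨I, le, u, M, hne, hdir, huJ, huM, hu⟩ := hB (pullback T ψ)
  obtain ⟨K, hK, hTK⟩ := (⟨T.toLinearMap, hT⟩ : B →L[ℂ] C).bound
  replace hTK : ∀ b, ‖T b‖ ≤ K * ‖b‖ := hTK
  refine ⟨I, le, fun i => T (u i), K * M, hne, hdir, fun i => map_mem_Jid T (huJ i),
    fun i => (hTK _).trans (by gcongr; exact huM i), fun c hc ε hε => ?_⟩
  obtain ⟨b, rfl⟩ := hs c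
  obtain ⟨i, hi⟩ := hu b hc (ε / K) (div_pos hε hK)
  refine ⟨i, fun j hj => ?_⟩
  rw [← map_mul, ← map_sub]
  exact (hTK _).trans_lt ((lt_div_iff₀' hK).mp (hi j hj))

end AutomaticContinuity

section FunctionAlgebra

variable {X : Type*} [TopologicalSpace X] {A : Type*} [NormedCommRing A] [NormedAlgebra ℂ A]
  {B : Type*} [NormedCommRing B] [NormedAlgebra ℂ B]
  (ι : B →ₐ[ℂ] C(X, A))

/-- Evaluation of the functions represented by `B` at a point. -/
def evalAt (x : X) : B →ₐ[ℂ] A :=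
  (ContinuousMap.evalAlgHom ℂ A x).comp ι

@[simp]
theorem evalAt_apply (x : X) (b : B) : evalAt ι x b = ι b x :=
  rfl

theorem character_algebraMap (φ : characterSpace ℂ A) (c : ℂ) : φ (algebraMap ℂ A c) = c :=
  AlgHomClass.commutes φ c

theorem mem_scalarSub_iff [CompleteSpace A] [Nontrivial A] (hss : IsSemisimple A) (b : B) :
    b ∈ scalarSub X A B ι ↔
      ∀ (x : X) (φ φ' : characterSpace ℂ A), φ (ι b x) = φ' (ι b x) := by
  constructor
  · intro hb x φ φ'
    obtain ⟨c, hc⟩ := hb x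
    rw [hc, character_algebraMap, character_algebraMap]
  · intro hb x
    obtain ⟨φ⟩ : Nonempty (characterSpace ℂ A) := inferInstance
    refine ⟨φ (ι b x), sub_eq_zero.mp (hss _ fun φ' => ?_)⟩
    rw [map_sub, character_algebraMap, hb x φ' φ, sub_self]

theorem isClosed_scalarSub [CompleteSpace A] [Nontrivial A] [CompleteSpace B]
    (hss : IsSemisimple A) :
    IsClosed (scalarSub X A B ι : Set B) := by
  have : (scalarSub X A B ι : Set B) =
      ⋂ (x : X) (φ : characterSpace ℂ A) (φ' : characterSpace ℂ A),
        {b | pullback (evalAt ι x) φ b = pullback (evalAt ι x) φ' b} := by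
    ext b
    simpa using mem_scalarSub_iff ι hss b
  rw [this]
  exact isClosed_iInter fun x => isClosed_iInter fun φ => isClosed_iInter fun φ' =>
    isClosed_eq (continuous_character _) (continuous_character _)

theorem isSemisimple_scalarSub [CompleteSpace A] [Nontrivial A]
    (hinj : Function.Injective ι) [CompleteSpace (scalarSub X A B ι)] :
    IsSemisimple (scalarSub X A B ι) := by
  intro g hg
  obtain ⟨φ⟩ : Nonempty (characterSpace ℂ A) := inferInstance
  refine Subtype.ext (hinj (ContinuousMap.ext fun x => ?_))
  obtain ⟨c, hc⟩ := g.2 x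
  have h : φ (ι g x) = 0 := hg (pullback ((evalAt ι x).comp (scalarSub X A B ι).val) φ)
  rw [hc, character_algebraMap] at h
  simp [hc, h]

theorem Admissible.exists_algHom {ι : B →ₐ[ℂ] C(X, A)} (hadm : Admissible X A B ι)
    (hinj : Function.Injective ι) (φ : characterSpace ℂ A) :
    ∃ P : B →ₐ[ℂ] scalarSub X A B ι, ∀ g : scalarSub X A B ι, P g = g := by
  choose p hp using fun f => hadm f φ
  have ext {f g : B} (h : ∀ x, ι f x = ι g x) : f = g := hinj (ContinuousMap.ext h)
  have hfix {f : B} (hf : f ∈ scalarSub X A B ι) : p f = f := by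
    refine ext fun x => ?_
    obtain ⟨c, hc⟩ := hf x
    rw [hp, hc, character_algebraMap]
  let P : B →ₐ[ℂ] B :=
    { toFun := p
      map_one' := hfix (one_mem _)
      map_zero' := hfix (zero_mem _)
      map_mul' := fun f g => ext fun x => by simp [hp]
      map_add' := fun f g => ext fun x => by simp [hp]
      commutes' := fun c => hfix (Subalgebra.algebraMap_mem _ c) }
  exact ⟨P.codRestrict _ fun f x => ⟨_, hp f x⟩, fun g => Subtype.ext (hfix g.2)⟩

end FunctionAlgebra

end VV

theorem ditkin_and_strongDitkin_inherited
    (X : Type*) [TopologicalSpace X] [CompactSpace X] [T2Space X]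
    (A : Type*) [NormedCommRing A] [NormedAlgebra ℂ A] [CompleteSpace A] [Nontrivial A]
    (hss : VV.IsSemisimple A)
    (B : Type*) [NormedCommRing B] [NormedAlgebra ℂ B] [CompleteSpace B] [Nontrivial B]
    (ι : B →ₐ[ℂ] C(X, A)) (hinj : Function.Injective ι)
    (hconst : VV.ContainsConstants X A B ι) (hsep : VV.Separates X A B ι)
    (hadm : VV.Admissible X A B ι) :
    (VV.IsDitkin B → VV.IsDitkin (VV.scalarSub X A B ι) ∧ VV.IsDitkin A) ∧
    (VV.IsStrongDitkin B →
      VV.IsStrongDitkin (VV.scalarSub X A B ι) ∧ VV.IsStrongDitkin A) := by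
  obtain ⟨φ⟩ : Nonempty (characterSpace ℂ A) := inferInstance
  obtain ⟨x⟩ : Nonempty X := by
    by_contra hX
    rw [not_nonempty_iff] at hX
    exact zero_ne_one (hinj (ContinuousMap.ext fun x => hX.elim x) : (0 : B) = 1)
  have hevalsurj : Function.Surjective (VV.evalAt ι x) := fun a =>
    (hconst a).imp fun _ hb => hb x
  have hevalcont : Continuous (VV.evalAt ι x) := hss.continuous_algHom _
  have : CompleteSpace (VV.scalarSub X A B ι) := (VV.isClosed_scalarSub ι hss).completeSpace_coe
  obtain ⟨P, hP⟩ := hadm.exists_algHom hinj φ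
  have hPsurj : Function.Surjective P := fun g => ⟨g, hP g⟩
  have hPcont : Continuous P := (VV.isSemisimple_scalarSub ι hinj).continuous_algHom P
  exact ⟨fun h => ⟨h.of_surjective hPcont hPsurj, h.of_surjective hevalcont hevalsurj⟩,
    fun h => ⟨h.of_surjective hPcont hPsurj, h.of_surjective hevalcont hevalsurj⟩⟩
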